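/- arXiv:1506.08770 — 4 statements merged into one kernel-verified Lean document; each statement's English description precedes it below -/
import Mathlib

section
/- For every integer k ≥ 2, every intersecting set of perfect matchings of K_{2k} has size at most (2k-3)!!, and this bound is attained; that is, the maximum size of a set of pairwise intersecting perfect matchings of K_{2k} equals (2k-3)!!. -/
/-- A perfect matching of the complete graph `K_{2k}` on vertex set `Fin (2*k)`,
given as a finite set of edges: every edge is a non-loop, and every vertex lies
in exactly one edge of the matching. -/
def IsPM (k : ℕ) (M : Finset (Sym2 (Fin (2 * k)))) : Prop :=
  (∀ e ∈ M, ¬ e.IsDiag) ∧ ∀ v : Fin (2 * k), ∃! e, e ∈ M ∧ v ∈ e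

/-- The type of perfect matchings of `K_{2k}`. -/
abbrev PM (k : ℕ) : Type := {M : Finset (Sym2 (Fin (2 * k))) // IsPM k M}

open Equiv Equiv.Perm in
theorem cycleType_of_involutive_of_forall_ne {α : Type*} [Fintype α] [DecidableEq α] {k : ℕ}
    (hα : Fintype.card α = 2 * k) (hk : 0 < k) {f : Perm α} (hinv : ∀ x, f (f x) = x)
    (hne : ∀ x, f x ≠ x) : f.cycleType = Multiset.replicate k 2 := by
  have hsupp : f.support = Finset.univ := by
    ext x; simp [hne x]
  have hord : orderOf f = 2 := by
    apply orderOf_eq_prime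
    · ext x; simp [pow_two, hinv]
    · rintro rfl
      have : Nonempty α := Fintype.card_pos_iff.1 (by lia)
      exact hne (Classical.arbitrary α) rfl
  obtain ⟨n, hn⟩ := cycleType_prime_order (σ := f) (by rw [hord]; exact Nat.prime_two)
  have hsum := f.sum_cycleType
  rw [hn, hord, hsupp, Finset.card_univ, hα, Multiset.sum_replicate, smul_eq_mul] at hsum
  rw [hn, hord, show n + 1 = k by lia]

open Equiv Equiv.Perm in
/-- The conjugations carrying one fixed-point-free involution of a set of size `2 * k` to another
one form a coset of a centralizer. -/
theorem card_conj_eq_of_involutive {α : Type*} [Fintype α] [DecidableEq α] {k : ℕ}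
    (hα : Fintype.card α = 2 * k) (hk : 0 < k) {f h : Perm α} (hf : ∀ x, f (f x) = x)
    (hf' : ∀ x, f x ≠ x) (hh : ∀ x, h (h x) = x) (hh' : ∀ x, h x ≠ x) :
    (Finset.univ.filter fun g : Perm α => g * f * g⁻¹ = h).card = 2 ^ k * k.factorial := by
  classical
  have hcf := cycleType_of_involutive_of_forall_ne hα hk hf hf'
  have hch := cycleType_of_involutive_of_forall_ne hα hk hh hh'
  obtain ⟨c, hc⟩ := isConj_iff.1 (isConj_iff_cycleType_eq.2 (hcf.trans hch.symm))
  have hcard := Equiv.Perm.nat_card_centralizer f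
  rw [hcf, hα] at hcard
  have hcent : Nat.card (Subgroup.centralizer {f}) = 2 ^ k * k.factorial := by
    rw [hcard, Multiset.toFinset_replicate, if_neg hk.ne']
    simp [mul_comm]
  rw [← hcent, Nat.card_eq_fintype_card, ← Finset.card_univ]
  refine Finset.card_bij' (fun g hg => ⟨c⁻¹ * g, ?_⟩) (fun g _ => c * g) ?_ ?_ ?_ ?_
  · rw [Finset.mem_filter] at hg
    rw [Subgroup.mem_centralizer_singleton_iff]
    have h1 : g * f = h * g := by rw [← hg.2]; group
    rw [mul_assoc, h1, ← hc]; group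
  · simp
  · rintro ⟨g, hg⟩ -
    rw [Subgroup.mem_centralizer_singleton_iff] at hg
    rw [Finset.mem_filter]
    refine ⟨Finset.mem_univ _, ?_⟩
    rw [← hc, mul_assoc c g f, hg]; group
  · intro g hg; simp
  · intro g hg; simp

open Equiv in
theorem sum_card_conj_mem {α ι : Type*} [Fintype α] [DecidableEq α] [Fintype ι] {k : ℕ}
    (hα : Fintype.card α = 2 * k) (hk : 0 < k) {F : ι → Perm α} (hF : ∀ i x, F i (F i x) = x)
    (hF' : ∀ i x, F i x ≠ x) {S : Finset (Perm α)}
    (hS : ∀ h ∈ S, ∀ x, h (h x) = x ∧ h x ≠ x) :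
    ∑ g : Perm α, (Finset.univ.filter fun i => g * F i * g⁻¹ ∈ S).card =
      Fintype.card ι * (S.card * (2 ^ k * k.factorial)) := by
  simp_rw [Finset.card_filter]
  rw [Finset.sum_comm]
  have key (i : ι) : ∑ g : Perm α, (if g * F i * g⁻¹ ∈ S then 1 else 0) =
      S.card * (2 ^ k * k.factorial) := by
    rw [← Finset.card_filter, Finset.card_eq_sum_card_fiberwise
      (f := fun g : Perm α => g * F i * g⁻¹) (t := S) (by intro g hg; simpa using hg),
      Finset.sum_const_nat]
    intro h hh
    rw [← card_conj_eq_of_involutive hα hk (hF i) (hF' i) (fun x => (hS h hh x).1)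
      (fun x => (hS h hh x).2), Finset.filter_filter]
    congr 1
    ext g
    simp only [Finset.mem_filter, Finset.mem_univ, true_and, and_iff_right_iff_imp]
    rintro rfl
    exact hh
  simp [key]

/-- The `a`-th round of the round-robin one-factorization of the complete graph on `R` with
a point at infinity adjoined: reflection through `a`, with `a` itself paired with infinity. -/
def roundRobin {R : Type*} [AddCommGroup R] [DecidableEq R] (a : R) : Option R → Option R
  | none => some a
  | some x => if x = a then none else some (a + a - x)

theorem roundRobin_involutive {R : Type*} [AddCommGroup R] [DecidableEq R] (a : R) :
    Function.Involutive (roundRobin a) := by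
  rintro (_ | x)
  · simp [roundRobin]
  · by_cases h : x = a
    · simp [roundRobin, h]
    · have : a + a - x ≠ a := fun h' => h (by
        rw [sub_eq_iff_eq_add] at h'; exact (add_left_cancel h').symm)
      simp [roundRobin, h, this]

theorem roundRobin_ne {R : Type*} [AddCommGroup R] [DecidableEq R]
    (hR : Function.Injective fun x : R => x + x) (a : R) (x : Option R) :
    roundRobin a x ≠ x := by
  rcases x with _ | x
  · simp [roundRobin]
  · by_cases h : x = a
    · simp [roundRobin, h]
    · simp only [roundRobin, h, if_false, ne_eq, Option.some.injEq]
      intro h'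
      exact h (hR (sub_eq_iff_eq_add.1 h')).symm

theorem existsUnique_roundRobin {R : Type*} [AddCommGroup R] [DecidableEq R]
    (hR : Function.Bijective fun x : R => x + x) {x y : Option R} (hxy : x ≠ y) :
    ∃! a, roundRobin a x = y := by
  rcases x with _ | x <;> rcases y with _ | y
  · exact absurd rfl hxy
  · simp [roundRobin]
  · refine ⟨x, by simp [roundRobin], fun a ha => ?_⟩
    by_contra h
    simp [roundRobin, Ne.symm h] at ha
  · obtain ⟨a, ha⟩ := hR.2 (x + y)
    have hxy' : x ≠ y := fun h => hxy (by rw [h])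
    have hxa : x ≠ a := by
      rintro rfl
      exact hxy' (add_left_cancel ha)
    refine ⟨a, ?_, fun b hb => hR.1 ?_⟩
    · simp only [roundRobin, hxa, if_false]
      rw [show a + a = x + y from ha, add_sub_cancel_left]
    · by_cases h : x = b
      · simp [roundRobin, h] at hb
      · simp only [roundRobin, h, if_false, Option.some.injEq, sub_eq_iff_eq_add] at hb
        change b + b = a + a
        rw [hb, show a + a = x + y from ha, add_comm]

theorem ZMod.bijective_add_self {n : ℕ} [NeZero n] (hn : Odd n) :
    Function.Bijective fun x : ZMod n => x + x := by
  rw [← Finite.injective_iff_bijective]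
  have h2 : IsUnit (2 : ZMod n) := by
    have := (ZMod.isUnit_iff_coprime 2 n).2 (Nat.coprime_two_left.2 hn)
    exact_mod_cast this
  intro x y hxy
  simp only [← two_mul] at hxy
  exact h2.mul_left_cancel hxy

open Equiv in
/-- A one-factorization of the complete graph on `2 * k` vertices, given as a family of
fixed-point-free involutions. -/
theorem exists_oneFactorization (k : ℕ) (hk : 0 < k) :
    ∃ F : Fin (2 * k - 1) → Perm (Fin (2 * k)), (∀ i x, F i (F i x) = x) ∧ (∀ i x, F i x ≠ x) ∧
      ∀ x y, x ≠ y → ∃! i, F i x = y := by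
  have : NeZero (2 * k - 1) := ⟨by lia⟩
  have hbij := ZMod.bijective_add_self (n := 2 * k - 1) ⟨k - 1, by lia⟩
  let e : Option (ZMod (2 * k - 1)) ≃ Fin (2 * k) :=
    Fintype.equivOfCardEq (by simp [ZMod.card]; lia)
  let d : Fin (2 * k - 1) ≃ ZMod (2 * k - 1) := Fintype.equivOfCardEq (by simp [ZMod.card])
  refine ⟨fun i => e.permCongr (roundRobin_involutive (d i)).toPerm, ?_, ?_, ?_⟩
  · intro i x
    simp [(roundRobin_involutive (d i)) _]
  · intro i x h
    exact roundRobin_ne hbij.1 (d i) (e.symm x) (by simpa [← Equiv.eq_symm_apply] using h)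
  · intro x y hxy
    obtain ⟨a, ha, hu⟩ := existsUnique_roundRobin hbij (e.symm.injective.ne hxy)
    refine ⟨d.symm a, by simp [ha], fun i hi => ?_⟩
    rw [← hu (d i) (by simpa [← Equiv.eq_symm_apply] using hi), Equiv.symm_apply_apply]

theorem factorial_two_mul_eq (k : ℕ) (hk : 2 ≤ k) :
    (2 * k).factorial =
      (2 * k - 1) * (Nat.doubleFactorial (2 * k - 3) * (2 ^ k * k.factorial)) := by
  obtain ⟨m, rfl⟩ := Nat.exists_eq_add_of_le' hk
  rw [show 2 * (m + 2) = (2 * m + 3) + 1 by ring, Nat.factorial_eq_mul_doubleFactorial,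
    show 2 * m + 3 + 1 = 2 * (m + 2) by ring, Nat.doubleFactorial_two_mul,
    show 2 * (m + 2) - 3 = 2 * m + 1 by lia, show 2 * (m + 2) - 1 = 2 * m + 3 by lia,
    Nat.doubleFactorial_add_two]
  ring

open Equiv in
theorem card_le_of_intersecting_involutions {k : ℕ} (hk : 2 ≤ k) {S : Finset (Perm (Fin (2 * k)))}
    (hS : ∀ h ∈ S, ∀ x, h (h x) = x ∧ h x ≠ x) (hint : ∀ g ∈ S, ∀ h ∈ S, ∃ x, g x = h x) :
    S.card ≤ Nat.doubleFactorial (2 * k - 3) := by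
  obtain ⟨F, hF, hF', hu⟩ := exists_oneFactorization k (by lia)
  have hsum := sum_card_conj_mem (Fintype.card_fin _) (by lia) hF hF' hS
  have hle : ∑ g : Perm (Fin (2 * k)), (Finset.univ.filter fun i => g * F i * g⁻¹ ∈ S).card ≤
      ∑ g : Perm (Fin (2 * k)), 1 := by
    refine Finset.sum_le_sum fun g _ => Finset.card_le_one.2 fun i hi j hj => ?_
    obtain ⟨x, hx⟩ := hint _ (Finset.mem_filter.1 hi).2 _ (Finset.mem_filter.1 hj).2
    have hx' : F i (g⁻¹ x) = F j (g⁻¹ x) := by simpa using hx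
    exact (hu _ _ (hF' i (g⁻¹ x)).symm).unique rfl hx'.symm
  rw [hsum, Finset.sum_const, Finset.card_univ, Fintype.card_perm, Fintype.card_fin, smul_eq_mul,
    mul_one, Fintype.card_fin, factorial_two_mul_eq k hk] at hle
  exact Nat.le_of_mul_le_mul_right (Nat.le_of_mul_le_mul_left hle (by lia)) (by positivity)

open Equiv in
theorem card_involutions_apply_eq {k : ℕ} (hk : 2 ≤ k) {x y : Fin (2 * k)} (hxy : x ≠ y) :
    (Finset.univ.filter fun h : Perm (Fin (2 * k)) =>
      (∀ z, h (h z) = z ∧ h z ≠ z) ∧ h x = y).card = Nat.doubleFactorial (2 * k - 3) := by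
  set S := Finset.univ.filter fun h : Perm (Fin (2 * k)) =>
      (∀ z, h (h z) = z ∧ h z ≠ z) ∧ h x = y with hS
  obtain ⟨F, hF, hF', hu⟩ := exists_oneFactorization k (by lia)
  have hsum := sum_card_conj_mem (S := S) (Fintype.card_fin _) (by lia) hF hF'
    fun h hh => (Finset.mem_filter.1 hh).2.1
  have hone : ∑ g : Perm (Fin (2 * k)), (Finset.univ.filter fun i => g * F i * g⁻¹ ∈ S).card =
      ∑ g : Perm (Fin (2 * k)), 1 := by
    refine Finset.sum_congr rfl fun g _ => ?_
    obtain ⟨i, hi, hi'⟩ := hu _ _ ((g⁻¹).injective.ne hxy)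
    refine Finset.card_eq_one.2 ⟨i, ?_⟩
    ext j
    simp only [hS, Finset.mem_filter, Finset.mem_univ, true_and, Finset.mem_singleton,
      Perm.mul_apply]
    constructor
    · rintro ⟨-, h⟩
      exact hi' j (by rw [← h]; simp)
    · rintro rfl
      refine ⟨fun z => ⟨by simp [hF], fun h => hF' j (g⁻¹ z) ?_⟩, by rw [hi]; simp⟩
      conv_rhs => rw [← h]
      simp
  rw [hsum, Finset.sum_const, Finset.card_univ, Fintype.card_perm, Fintype.card_fin, smul_eq_mul,
    mul_one, Fintype.card_fin, factorial_two_mul_eq k hk] at hone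
  exact Nat.eq_of_mul_eq_mul_right (by positivity)
    (Nat.eq_of_mul_eq_mul_left (by lia) hone)

theorem IsPM.exists_perm {k : ℕ} {M : Finset (Sym2 (Fin (2 * k)))} (hM : IsPM k M) :
    ∃ f : Equiv.Perm (Fin (2 * k)), (∀ x, f (f x) = x ∧ f x ≠ x) ∧ ∀ x y, s(x, y) ∈ M ↔ f x = y := by
  have hex (x : Fin (2 * k)) : ∃ y, s(x, y) ∈ M := by
    obtain ⟨e, ⟨he, hxe⟩, -⟩ := hM.2 x
    obtain ⟨y, rfl⟩ := hxe
    exact ⟨y, he⟩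
  choose f hf using hex
  have hiff (x y : Fin (2 * k)) : s(x, y) ∈ M ↔ f x = y := by
    refine ⟨fun h => ?_, fun h => h ▸ hf x⟩
    have := (hM.2 x).unique ⟨hf x, Sym2.mem_mk_left _ _⟩ ⟨h, Sym2.mem_mk_left _ _⟩
    exact Sym2.congr_right.1 this
  have hinv : Function.Involutive f := fun x => (hiff _ _).1 (Sym2.eq_swap ▸ hf x)
  exact ⟨hinv.toPerm, fun x => ⟨hinv x, fun h => hM.1 _ (hf x) (Sym2.mk_isDiag_iff.2 h.symm)⟩, hiff⟩

theorem exists_isPM_of_involutive {k : ℕ} {f : Equiv.Perm (Fin (2 * k))}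
    (hf : ∀ x, f (f x) = x ∧ f x ≠ x) :
    ∃ M : Finset (Sym2 (Fin (2 * k))), IsPM k M ∧ ∀ x y, s(x, y) ∈ M ↔ f x = y := by
  have hiff (x y : Fin (2 * k)) : s(x, y) ∈ Finset.univ.image (fun v => s(v, f v)) ↔ f x = y := by
    simp only [Finset.mem_image, Finset.mem_univ, true_and, Sym2.eq_iff]
    constructor
    · rintro ⟨v, ⟨rfl, rfl⟩ | ⟨rfl, rfl⟩⟩
      · rfl
      · exact (hf _).1
    · rintro rfl
      exact ⟨x, Or.inl ⟨rfl, rfl⟩⟩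
  refine ⟨Finset.univ.image (fun v => s(v, f v)), ⟨?_, fun v => ?_⟩, hiff⟩
  · intro e
    induction e with | _ x y
    rw [hiff, Sym2.mk_isDiag_iff]
    rintro rfl h
    exact (hf x).2 h.symm
  · refine ⟨s(v, f v), ⟨(hiff _ _).2 rfl, Sym2.mem_mk_left _ _⟩, ?_⟩
    rintro e ⟨he, w, rfl⟩
    rw [(hiff _ _).1 he]

/-- Perfect matchings correspond to fixed-point-free involutions, sending each vertex to its
partner. -/
noncomputable def PM.toPerm {k : ℕ} (M : PM k) : Equiv.Perm (Fin (2 * k)) :=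
  M.2.exists_perm.choose

theorem PM.toPerm_spec {k : ℕ} (M : PM k) (x : Fin (2 * k)) :
    M.toPerm (M.toPerm x) = x ∧ M.toPerm x ≠ x :=
  M.2.exists_perm.choose_spec.1 x

theorem PM.mk_mem_iff {k : ℕ} (M : PM k) (x y : Fin (2 * k)) :
    s(x, y) ∈ M.1 ↔ M.toPerm x = y :=
  M.2.exists_perm.choose_spec.2 x y

theorem PM.toPerm_injective {k : ℕ} : Function.Injective (PM.toPerm (k := k)) := by
  intro M N h
  ext e
  induction e with | _ x y
  rw [M.mk_mem_iff, N.mk_mem_iff, h]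

theorem PM.exists_toPerm_eq {k : ℕ} {f : Equiv.Perm (Fin (2 * k))}
    (hf : ∀ x, f (f x) = x ∧ f x ≠ x) : ∃ M : PM k, M.toPerm = f := by
  obtain ⟨M, hM, h⟩ := exists_isPM_of_involutive hf
  refine ⟨⟨M, hM⟩, Equiv.ext fun x => ?_⟩
  rw [← PM.mk_mem_iff]
  exact (h _ _).2 rfl

/-- for `k ≥ 2`, the maximum size of a set of pairwise intersecting
perfect matchings of `K_{2k}` (any two members share a common edge) equals
`(2k-3)!!`: every intersecting set has size at most `(2k-3)!!` and this bound
is attained. -/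
theorem stmt_5 (k : ℕ) (hk : 2 ≤ k) :
    IsGreatest {n : ℕ | ∃ S : Finset (PM k),
        (∀ M ∈ S, ∀ N ∈ S, ∃ e, e ∈ M.1 ∧ e ∈ N.1) ∧ S.card = n}
      (Nat.doubleFactorial (2 * k - 3)) := by
  classical
  constructor
  · let x : Fin (2 * k) := ⟨0, by lia⟩
    let y : Fin (2 * k) := ⟨1, by lia⟩
    have hxy : x ≠ y := by simp [x, y]
    refine ⟨Finset.univ.filter fun M => s(x, y) ∈ M.1, fun M hM N hN =>
      ⟨s(x, y), (Finset.mem_filter.1 hM).2, (Finset.mem_filter.1 hN).2⟩, ?_⟩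
    rw [← card_involutions_apply_eq hk hxy, ← Finset.card_image_of_injective _ PM.toPerm_injective]
    congr 1
    ext f
    simp only [Finset.mem_image, Finset.mem_filter, Finset.mem_univ, true_and]
    constructor
    · rintro ⟨M, hM, rfl⟩
      exact ⟨M.toPerm_spec, (M.mk_mem_iff _ _).1 hM⟩
    · rintro ⟨hf, hfx⟩
      obtain ⟨M, rfl⟩ := PM.exists_toPerm_eq hf
      exact ⟨M, (M.mk_mem_iff _ _).2 hfx, rfl⟩
  · rintro _ ⟨S, hS, rfl⟩
    rw [← Finset.card_image_of_injective S PM.toPerm_injective]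
    refine card_le_of_intersecting_involutions hk ?_ ?_
    · simp only [Finset.mem_image]
      rintro _ ⟨M, -, rfl⟩
      exact M.toPerm_spec
    · simp only [Finset.mem_image]
      rintro _ ⟨M, hM, rfl⟩ _ ⟨N, hN, rfl⟩
      obtain ⟨e, heM, heN⟩ := hS M hM N hN
      induction e with | _ x y
      exact ⟨x, ((M.mk_mem_iff x y).1 heM).trans ((N.mk_mem_iff x y).1 heN).symm⟩
end

section
/- Let k ≥ 2, let e be an edge of K_{2k}, and let N be a perfect matching of K_{2k} that does not contain e. Then the number of perfect matchings M of K_{2k} that contain e and share no edge with N equals d(2k)/(2k-2); that is, (2k-2) times this number equals d(2k). (In particular, the partition of the vertices of M(2k) into S_e and its complement is equitable.) -/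
open Equiv

/-- The fixed-point-free involutions of `α`. -/
abbrev FixedPointFreeInvolution (α : Type*) : Type _ :=
  {f : Perm α // (∀ v, f (f v) = v) ∧ ∀ v, f v ≠ v}

namespace FixedPointFreeInvolution

variable {α : Type*}

/-- Conjugation by a permutation, as a permutation of the fixed-point-free involutions. -/
def conj (σ : Perm α) : FixedPointFreeInvolution α ≃ FixedPointFreeInvolution α :=
  (MulAut.conj σ).toEquiv.subtypeEquiv fun f => by
    simp only [MulEquiv.toEquiv_eq_coe, MulEquiv.coe_toEquiv, MulAut.conj_apply, Perm.mul_apply,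
      Perm.inv_def, symm_apply_apply]
    refine and_congr ⟨fun h v => by simp [h], fun h v => ?_⟩
      ⟨fun h v hv => h (σ⁻¹ v) ?_, fun h v hv => h (σ v) (by simp [hv])⟩
    · simpa using h (σ v)
    · exact Perm.eq_inv_iff_eq.2 hv

@[simp]
theorem conj_apply (σ : Perm α) (f : FixedPointFreeInvolution α) (v : α) :
    (conj σ f).1 (σ v) = σ (f.1 v) := by
  simp [conj]

theorem card_conj (σ : Perm α) (n : FixedPointFreeInvolution α) :
    Nat.card {p : FixedPointFreeInvolution α // ∀ v, p.1 v ≠ n.1 v} =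
      Nat.card {p : FixedPointFreeInvolution α // ∀ v, p.1 v ≠ (conj σ n).1 v} := by
  refine Nat.card_congr ((conj σ).subtypeEquiv fun p => ?_)
  rw [← σ.forall_congr_right (q := fun v => (conj σ p).1 v ≠ (conj σ n).1 v)]
  simp

theorem card_apply_eq_conj (σ : Perm α) (n : FixedPointFreeInvolution α) (a b : α) :
    Nat.card {p : FixedPointFreeInvolution α // p.1 a = b ∧ ∀ v, p.1 v ≠ n.1 v} =
      Nat.card {p : FixedPointFreeInvolution α //
        p.1 (σ a) = σ b ∧ ∀ v, p.1 v ≠ (conj σ n).1 v} := by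
  refine Nat.card_congr ((conj σ).subtypeEquiv fun p => ?_)
  rw [← σ.forall_congr_right (q := fun v => (conj σ p).1 v ≠ (conj σ n).1 v)]
  simp

/-- The centralizer of a fixed-point-free involution `n` acts so that the stabilizer of `a` is
transitive on the points other than `a` and `n a`. -/
theorem exists_conj_eq_self [DecidableEq α] (n : FixedPointFreeInvolution α) {a b c : α}
    (hba : b ≠ a) (hb : b ≠ n.1 a) (hca : c ≠ a) (hc : c ≠ n.1 a) :
    ∃ σ : Perm α, conj σ n = n ∧ σ a = a ∧ σ b = c := by
  obtain ⟨f, hf, hf'⟩ := n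
  suffices h : ∃ σ : Perm α, (∀ v, σ (f v) = f (σ v)) ∧ σ a = a ∧ σ b = c by
    obtain ⟨σ, h, ha, hbc⟩ := h
    refine ⟨σ, Subtype.ext (Equiv.ext fun v => ?_), ha, hbc⟩
    obtain ⟨w, rfl⟩ := σ.surjective v
    simp [h]
  by_cases hcb : c = f b
  · refine ⟨swap b c, fun v => ?_, ?_, ?_⟩ <;> simp only [swap_apply_def] <;> grind
  · refine ⟨swap b c * swap (f b) (f c), fun v => ?_, ?_, ?_⟩ <;>
      simp only [Perm.mul_apply, swap_apply_def] <;> grind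

theorem exists_conj_eq [Fintype α] [DecidableEq α] (m n : FixedPointFreeInvolution α) :
    ∃ σ : Perm α, conj σ m = n := by
  have key : ∀ f : FixedPointFreeInvolution α,
      f.1.cycleType = Multiset.replicate (Fintype.card α / 2) 2 := by
    intro f
    have h2 : ∀ c ∈ f.1.cycleType, c = 2 := fun c hc =>
      le_antisymm (Nat.le_of_dvd two_pos ((Perm.dvd_of_mem_cycleType hc).trans
        (orderOf_dvd_of_pow_eq_one (by ext v; simp [pow_two, f.2.1]))))
        (Perm.two_le_of_mem_cycleType hc)
    have hs : f.1.support = Finset.univ := by ext v; simp [f.2.2 v]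
    have h := Multiset.eq_replicate_of_mem h2
    have hsum := f.1.sum_cycleType
    rw [hs, Finset.card_univ, h, Multiset.sum_replicate, smul_eq_mul] at hsum
    rw [h, ← hsum]
    simp
  obtain ⟨σ, h⟩ := isConj_iff.1 (Perm.isConj_iff_cycleType_eq.2 ((key m).trans (key n).symm))
  exact ⟨σ, Subtype.ext h⟩

/-- Among the fixed-point-free involutions disagreeing everywhere with `n`, every admissible value
at `a` is taken equally often. -/
theorem mul_card_apply_eq [Fintype α] (n : FixedPointFreeInvolution α) {a b : α}
    (hba : b ≠ a) (hb : b ≠ n.1 a) :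
    (Fintype.card α - 2) *
        Nat.card {p : FixedPointFreeInvolution α // p.1 a = b ∧ ∀ v, p.1 v ≠ n.1 v} =
      Nat.card {p : FixedPointFreeInvolution α // ∀ v, p.1 v ≠ n.1 v} := by
  classical
  have hcard : ((Finset.univ : Finset α) \ {a, n.1 a}).card = Fintype.card α - 2 := by
    rw [Finset.card_sdiff_of_subset (Finset.subset_univ _), Finset.card_univ,
      Finset.card_pair (n.2.2 a).symm]
  rw [Nat.card_eq_fintype_card (α := {p : FixedPointFreeInvolution α // ∀ v, p.1 v ≠ n.1 v}),
    Fintype.card_subtype, Finset.card_eq_sum_card_fiberwise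
      (f := fun p : FixedPointFreeInvolution α => p.1 a) (t := Finset.univ \ {a, n.1 a})
      (fun p hp => by simpa using ⟨p.2.2 a, (Finset.mem_filter.1 hp).2 a⟩),
    ← hcard, ← smul_eq_mul, ← Finset.sum_const]
  refine Finset.sum_congr rfl fun c hc => ?_
  simp only [Finset.mem_sdiff, Finset.mem_univ, true_and, Finset.mem_insert,
    Finset.mem_singleton, not_or] at hc
  obtain ⟨σ, hσ, ha, hbc⟩ := exists_conj_eq_self n hba hb hc.1 hc.2
  rw [card_apply_eq_conj σ, hσ, ha, hbc, Nat.card_eq_fintype_card, Fintype.card_subtype,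
    Finset.filter_filter]
  simp only [and_comm]

end FixedPointFreeInvolution

namespace PM

variable {k : ℕ}

/-- The perfect matching whose edges are the orbits of a fixed-point-free involution. -/
def ofInvolution (f : FixedPointFreeInvolution (Fin (2 * k))) : PM k :=
  ⟨Finset.univ.image fun v => s(v, f.1 v), by
    refine ⟨fun e he => ?_, fun v => ⟨s(v, f.1 v), by simp, ?_⟩⟩
    · obtain ⟨v, -, rfl⟩ := Finset.mem_image.1 he
      simpa using (f.2.2 v).symm
    · rintro e ⟨he, hv⟩
      obtain ⟨w, -, rfl⟩ := Finset.mem_image.1 he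
      rcases Sym2.mem_iff.1 hv with rfl | rfl
      · rfl
      · rw [f.2.1, Sym2.eq_swap]⟩

theorem mk_mem_ofInvolution (f : FixedPointFreeInvolution (Fin (2 * k))) (a b : Fin (2 * k)) :
    s(a, b) ∈ (ofInvolution f).1 ↔ f.1 a = b := by
  simp only [ofInvolution, Finset.mem_image, Finset.mem_univ, true_and, Sym2.eq_iff]
  constructor
  · rintro ⟨v, ⟨rfl, rfl⟩ | ⟨rfl, rfl⟩⟩
    · rfl
    · exact f.2.1 _
  · exact fun h => ⟨a, .inl ⟨rfl, h⟩⟩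

theorem ofInvolution_bijective : Function.Bijective (ofInvolution (k := k)) := by
  refine ⟨fun f g h => Subtype.ext (Equiv.ext fun v => ?_), fun M => ?_⟩
  · exact ((mk_mem_ofInvolution g _ _).1 (h ▸ (mk_mem_ofInvolution f _ _).2 rfl)).symm
  · have hex : ∀ v, ∃ w, s(v, w) ∈ M.1 := fun v => by
      obtain ⟨e, ⟨he, w, rfl⟩, -⟩ := M.2.2 v
      exact ⟨w, he⟩
    have huniq : ∀ v w w', s(v, w) ∈ M.1 → s(v, w') ∈ M.1 → w = w' := fun v w w' h h' =>
      Sym2.congr_right.1 ((M.2.2 v).unique ⟨h, Sym2.mem_mk_left _ _⟩ ⟨h', Sym2.mem_mk_left _ _⟩)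
    choose f hf using hex
    have hinv : Function.Involutive f := fun v =>
      huniq (f v) _ _ (hf (f v)) (Sym2.eq_swap ▸ hf v)
    refine ⟨⟨hinv.toPerm, hinv, fun v hv => M.2.1 _ (hf v) ?_⟩,
      Subtype.ext (Finset.ext fun e => ?_)⟩
    · exact Sym2.mk_isDiag_iff.2 hv.symm
    · induction e with | _ a b
      rw [mk_mem_ofInvolution]
      exact ⟨fun h => h ▸ hf a, huniq a _ _ (hf a)⟩

/-- Perfect matchings correspond to fixed-point-free involutions. -/
noncomputable def involutionEquiv : FixedPointFreeInvolution (Fin (2 * k)) ≃ PM k :=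
  Equiv.ofBijective ofInvolution ofInvolution_bijective

theorem mk_mem_involutionEquiv (f : FixedPointFreeInvolution (Fin (2 * k))) (a b : Fin (2 * k)) :
    s(a, b) ∈ (involutionEquiv f).1 ↔ f.1 a = b :=
  mk_mem_ofInvolution f a b

theorem disjoint_involutionEquiv (f g : FixedPointFreeInvolution (Fin (2 * k))) :
    Disjoint (involutionEquiv f).1 (involutionEquiv g).1 ↔ ∀ v, f.1 v ≠ g.1 v := by
  simp only [Finset.disjoint_left, Sym2.forall, mk_mem_involutionEquiv]
  exact ⟨fun h v hv => h v _ rfl hv.symm, fun h a b hf hg => h a (hf.trans hg.symm)⟩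

end PM

/-- let `e` be an edge of `K_{2k}` and `N` a perfect matching not
containing `e`.  Then `(2k-2)` times the number of perfect matchings that
contain `e` and share no edge with `N` equals `d(2k)`, the number of perfect
matchings sharing no edge with a fixed perfect matching `M₀` (this count being
independent of `M₀`). -/
theorem stmt_7 (k : ℕ) (hk : 2 ≤ k) (e : Sym2 (Fin (2 * k))) (he : ¬ e.IsDiag)
    (N : PM k) (heN : e ∉ N.1) (M₀ : PM k) :
    (2 * k - 2) * Nat.card {M : PM k // e ∈ M.1 ∧ Disjoint M.1 N.1} =
      Nat.card {P : PM k // Disjoint M₀.1 P.1} := by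
  obtain ⟨n, rfl⟩ := PM.involutionEquiv.surjective N
  obtain ⟨m, rfl⟩ := PM.involutionEquiv.surjective M₀
  induction e with | _ a b
  rw [PM.mk_mem_involutionEquiv] at heN
  rw [Sym2.mk_isDiag_iff] at he
  obtain ⟨σ, rfl⟩ := FixedPointFreeInvolution.exists_conj_eq n m
  have h := FixedPointFreeInvolution.mul_card_apply_eq n (Ne.symm he) (Ne.symm heN)
  rw [Fintype.card_fin, FixedPointFreeInvolution.card_conj σ] at h
  refine (congrArg _ (Nat.card_congr ?_)).trans (h.trans (Nat.card_congr ?_))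
  · refine (PM.involutionEquiv.subtypeEquiv fun p => ?_).symm
    rw [PM.mk_mem_involutionEquiv, PM.disjoint_involutionEquiv]
  · refine PM.involutionEquiv.subtypeEquiv fun p => ?_
    rw [disjoint_comm, PM.disjoint_involutionEquiv]
end

section
/- Let k ≥ 2 and let U be the perfect matching incidence matrix of K_{2k}. Then the rank of U over ℝ equals 2k² - 3k + 1. -/
noncomputable instance (k : ℕ) : Fintype (PM k) := Fintype.ofFinite _

/-- The perfect matching incidence matrix `U` of `K_{2k}`: rows are indexed by
the perfect matchings, columns by the edges of `K_{2k}` (the non-diagonal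
elements of `Sym2 (Fin (2k))`), with entry `1` exactly when the matching
contains the edge. -/
noncomputable def pmIncidence (k : ℕ) :
    Matrix (PM k) {e : Sym2 (Fin (2 * k)) // ¬ e.IsDiag} ℝ :=
  fun M e => if e.1 ∈ M.1 then 1 else 0

/-- The edge weighting of a complete graph obtained from a vertex weighting by adding the weights
of the two endpoints. -/
def endpointSum (k : ℕ) :
    (Fin (2 * k) → ℝ) →ₗ[ℝ] ({e : Sym2 (Fin (2 * k)) // ¬ e.IsDiag} → ℝ) where
  toFun a e := ∑ v, if v ∈ e.1 then a v else 0
  map_add' a b := by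
    ext e
    simp only [Pi.add_apply, ← Finset.sum_add_distrib]
    exact Finset.sum_congr rfl fun v _ => by split_ifs <;> simp
  map_smul' c a := by
    ext e
    simp only [Pi.smul_apply, smul_eq_mul, Finset.mul_sum, RingHom.id_apply]
    exact Finset.sum_congr rfl fun v _ => by split_ifs <;> simp

/-- The total weight of a vertex weighting. -/
def vertexTotal (k : ℕ) : (Fin (2 * k) → ℝ) →ₗ[ℝ] ℝ := ∑ v, LinearMap.proj v

theorem vertexTotal_apply {k : ℕ} (a : Fin (2 * k) → ℝ) : vertexTotal k a = ∑ v, a v := by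
  simp [vertexTotal]

theorem endpointSum_mk {k : ℕ} (a : Fin (2 * k) → ℝ) {u v : Fin (2 * k)} (h : ¬ s(u, v).IsDiag) :
    endpointSum k a ⟨s(u, v), h⟩ = a u + a v := by
  have huv : u ≠ v := by simpa using h
  change (∑ w, if w ∈ s(u, v) then a w else 0) = _
  rw [Fintype.sum_eq_add u v huv]
  · simp
  · rintro w ⟨h1, h2⟩
    simp [h1, h2]

/-- Each matching sees the total vertex weight of an endpoint sum. -/
theorem pmIncidence_mulVec_endpointSum {k : ℕ} (a : Fin (2 * k) → ℝ) (M : PM k) :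
    (pmIncidence k).mulVec (endpointSum k a) M = ∑ v, a v := by
  have key (v : Fin (2 * k)) : (∑ e : {e : Sym2 (Fin (2 * k)) // ¬ e.IsDiag},
      if e.1 ∈ M.1 ∧ v ∈ e.1 then a v else 0) = a v := by
    obtain ⟨e, ⟨heM, hve⟩, hu⟩ := M.2.2 v
    rw [Fintype.sum_eq_single ⟨e, M.2.1 e heM⟩]
    · simp [heM, hve]
    · intro e' hne
      refine if_neg fun h => hne ?_
      exact Subtype.ext (hu e'.1 h)
  calc (pmIncidence k).mulVec (endpointSum k a) M
      = ∑ e : {e : Sym2 (Fin (2 * k)) // ¬ e.IsDiag}, ∑ v,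
          if e.1 ∈ M.1 ∧ v ∈ e.1 then a v else 0 := by
        rw [Matrix.mulVec, dotProduct]
        refine Finset.sum_congr rfl fun e _ => ?_
        change (if e.1 ∈ M.1 then (1 : ℝ) else 0) * (∑ v, if v ∈ e.1 then a v else 0) = _
        by_cases h : e.1 ∈ M.1 <;> simp [h]
    _ = ∑ v, a v := by
        rw [Finset.sum_comm]
        exact Finset.sum_congr rfl fun v _ => key v

/-- The edge joining the `i`-th pair of an enumeration of the vertices in pairs. -/
def pairEdge {k : ℕ} (p : Fin k × Bool ≃ Fin (2 * k)) (i : Fin k) : Sym2 (Fin (2 * k)) :=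
  s(p (i, false), p (i, true))

theorem apply_mem_pairEdge {k : ℕ} (p : Fin k × Bool ≃ Fin (2 * k)) (i j : Fin k) (b : Bool) :
    p (j, b) ∈ pairEdge p i ↔ j = i := by
  cases b <;> simp [pairEdge]

theorem pairEdge_injective {k : ℕ} (p : Fin k × Bool ≃ Fin (2 * k)) :
    Function.Injective (pairEdge p) := by
  intro i j h
  rw [← apply_mem_pairEdge p j i true, ← h, apply_mem_pairEdge]

theorem pairEdge_not_isDiag {k : ℕ} (p : Fin k × Bool ≃ Fin (2 * k)) (i : Fin k) :
    ¬ (pairEdge p i).IsDiag := by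
  simp [pairEdge]

/-- The perfect matching given by an enumeration of the vertices in pairs. -/
def pairMatching {k : ℕ} (p : Fin k × Bool ≃ Fin (2 * k)) : PM k :=
  ⟨Finset.univ.image (pairEdge p), by
    constructor
    · intro e he
      obtain ⟨i, -, rfl⟩ := Finset.mem_image.1 he
      exact pairEdge_not_isDiag p i
    · intro v
      obtain ⟨⟨j, b⟩, rfl⟩ := p.surjective v
      refine ⟨pairEdge p j, ⟨Finset.mem_image_of_mem _ (Finset.mem_univ j),
        (apply_mem_pairEdge p j j b).2 rfl⟩, ?_⟩
      rintro e ⟨he, hv⟩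
      obtain ⟨i, -, rfl⟩ := Finset.mem_image.1 he
      rw [(apply_mem_pairEdge p i j b).1 hv]⟩

theorem pmIncidence_mulVec_pairMatching {k : ℕ} (p : Fin k × Bool ≃ Fin (2 * k))
    (f : {e : Sym2 (Fin (2 * k)) // ¬ e.IsDiag} → ℝ) :
    (pmIncidence k).mulVec f (pairMatching p)
      = ∑ i, f ⟨pairEdge p i, pairEdge_not_isDiag p i⟩ := by
  symm
  change _ = ∑ e : {e : Sym2 (Fin (2 * k)) // ¬ e.IsDiag},
    (if e.1 ∈ (pairMatching p).1 then (1 : ℝ) else 0) * f e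
  simp only [ite_mul, one_mul, zero_mul]
  rw [← Finset.sum_filter]
  refine Finset.sum_bij (fun i _ => ⟨pairEdge p i, pairEdge_not_isDiag p i⟩) ?_ ?_ ?_ ?_
  · intro i _
    simp [pairMatching]
  · intro i _ j _ h
    exact pairEdge_injective p (congrArg Subtype.val h)
  · rintro ⟨e, he⟩ h
    obtain ⟨i, -, hi⟩ := Finset.mem_image.1 (Finset.mem_filter.1 h).2
    exact ⟨i, Finset.mem_univ i, Subtype.ext hi⟩
  · intro i _
    rfl

theorem exists_pairing {k : ℕ} {i j : Fin k} (hij : i ≠ j) {a b c d : Fin (2 * k)}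
    (h : [a, b, c, d].Nodup) :
    ∃ p : Fin k × Bool ≃ Fin (2 * k),
      p (i, false) = a ∧ p (i, true) = b ∧ p (j, false) = c ∧ p (j, true) = d := by
  have e : Fin k × Bool ≃ Fin (2 * k) := Fintype.equivOfCardEq (by simp [mul_comm])
  let x : Fin 4 ↪ Fin (2 * k) :=
    ⟨fun t => [e (i, false), e (i, true), e (j, false), e (j, true)].get t, by
      have hx : [e (i, false), e (i, true), e (j, false), e (j, true)].Nodup := by simp [hij]
      exact List.nodup_iff_injective_get.1 hx⟩
  let y : Fin 4 ↪ Fin (2 * k) := ⟨fun t => [a, b, c, d].get t,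
    List.nodup_iff_injective_get.1 h⟩
  obtain ⟨g, hg⟩ :=
    (Equiv.Perm.isMultiplyPretransitive (Fin (2 * k)) 4).exists_smul_eq x y
  have hg' (t : Fin 4) : g (x t) = y t := by rw [← hg]; rfl
  exact ⟨e.trans g, hg' 0, hg' 1, hg' 2, hg' 3⟩

/-- Exchanging two edges of a matching on four vertices preserves the weight of any edge
weighting that vanishes on all perfect matchings. -/
theorem exchange_of_mulVec_eq_zero {k : ℕ} (hk : 2 ≤ k)
    {f : {e : Sym2 (Fin (2 * k)) // ¬ e.IsDiag} → ℝ} (hf : (pmIncidence k).mulVec f = 0)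
    {F : Fin (2 * k) → Fin (2 * k) → ℝ}
    (hF : ∀ u v (h : ¬ s(u, v).IsDiag), f ⟨s(u, v), h⟩ = F u v)
    {a b c d : Fin (2 * k)} (h : [a, b, c, d].Nodup) :
    F a b + F c d = F a c + F b d := by
  have hij : (⟨0, by omega⟩ : Fin k) ≠ ⟨1, by omega⟩ := by simp
  generalize (⟨0, by omega⟩ : Fin k) = i at hij
  generalize (⟨1, by omega⟩ : Fin k) = j at hij
  have sum_zero (p : Fin k × Bool ≃ Fin (2 * k)) :
      ∑ t, F (p (t, false)) (p (t, true)) = 0 := by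
    have := pmIncidence_mulVec_pairMatching p f
    rw [hf] at this
    simpa [pairEdge, hF] using this.symm
  obtain ⟨p, rfl, rfl, rfl, rfl⟩ := exists_pairing hij h
  have h1 := sum_zero p
  have h2 := sum_zero ((Equiv.swap (i, true) (j, false)).trans p)
  have h3 := (Finset.sum_sub_distrib _ _).trans (congrArg₂ (· - ·) h1 h2)
  rw [Fintype.sum_eq_add i j hij] at h3
  · have e1 : Equiv.swap (i, true) (j, false) (i, false) = (i, false) :=
      Equiv.swap_apply_of_ne_of_ne (by simp) (by simp [hij])
    have e2 : Equiv.swap (i, true) (j, false) (j, true) = (j, true) :=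
      Equiv.swap_apply_of_ne_of_ne (by simp [hij.symm]) (by simp)
    simp only [Equiv.trans_apply, Equiv.swap_apply_left, Equiv.swap_apply_right, e1, e2] at h3
    linarith
  · rintro t ⟨hi, hj⟩
    simp only [Equiv.trans_apply]
    rw [Equiv.swap_apply_of_ne_of_ne (by simp) (by simp [hj]),
      Equiv.swap_apply_of_ne_of_ne (by simp [hi]) (by simp), sub_self]

/-- A symmetric edge weighting satisfying the exchange property is an endpoint sum. -/
theorem exists_add_of_exchange {V : Type*} {F : V → V → ℝ} (symm : ∀ u v, F u v = F v u)
    (hF : ∀ a b c d, [a, b, c, d].Nodup → F a b + F c d = F a c + F b d)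
    {o x y : V} (hne : [o, x, y].Nodup) :
    ∃ a : V → ℝ, ∀ u v, u ≠ v → F u v = a u + a v := by
  classical
  obtain ⟨hox, hoy, hxy⟩ : o ≠ x ∧ o ≠ y ∧ x ≠ y := by simpa [and_assoc] using hne
  have step {u v w : V} (hu : u ≠ o) (hv : v ≠ o) (hw : w ≠ o) (huv : u ≠ v) (huw : u ≠ w) :
      F o u + F o v - F u v = F o u + F o w - F u w := by
    by_cases hvw : v = w
    · rw [hvw]
    · have := hF o v w u (by simp; tauto)
      rw [symm w u, symm v u] at this
      linarith
  have const {u v : V} (hu : u ≠ o) (hv : v ≠ o) (huv : u ≠ v) :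
      F o u + F o v - F u v = F o x + F o y - F x y := by
    by_cases hux : u = x
    · subst hux
      exact step hu hv hoy.symm huv hxy
    · have h1 := step hu hv hox.symm huv hux
      have h2 := step hox.symm hu hoy.symm (Ne.symm hux) hxy
      have h3 := symm u x
      linarith
  refine ⟨fun u => if u = o then (F o x + F o y - F x y) / 2
    else F o u - (F o x + F o y - F x y) / 2, fun u v huv => ?_⟩
  by_cases hu : u = o
  · subst hu
    simp [huv.symm]
  · by_cases hv : v = o
    · subst hv
      simp [hu, symm u v]
    · simp only [hu, hv, if_false]
      have := const hu hv huv
      linarith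

theorem nodup_three {k : ℕ} (hk : 2 ≤ k) :
    [(⟨0, by omega⟩ : Fin (2 * k)), ⟨1, by omega⟩, ⟨2, by omega⟩].Nodup := by
  simp

theorem endpointSum_injective {k : ℕ} (hk : 2 ≤ k) : Function.Injective (endpointSum k) := by
  rw [← LinearMap.ker_eq_bot, LinearMap.ker_eq_bot']
  intro a ha
  have add_zero' {u v : Fin (2 * k)} (h : u ≠ v) : a u + a v = 0 := by
    rw [← endpointSum_mk a (u := u) (v := v) (by simpa using h), ha]
    rfl
  funext u
  obtain ⟨v, hv⟩ := Finset.exists_mem_notMem_of_card_lt_card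
    (s := {u}) (t := (Finset.univ : Finset (Fin (2 * k)))) (by simp; omega)
  obtain ⟨w, hw⟩ := Finset.exists_mem_notMem_of_card_lt_card
    (s := {u, v}) (t := (Finset.univ : Finset (Fin (2 * k))))
    (by have := Finset.card_le_two (a := u) (b := v); simp only [Finset.card_fin]; omega)
  simp only [Finset.mem_univ, Finset.mem_insert, Finset.mem_singleton, true_and, not_or] at hv hw
  have h1 := add_zero' hv
  have h2 := add_zero' hw.1
  have h3 := add_zero' hw.2
  simp only [Pi.zero_apply]
  linarith

theorem ker_pmIncidence {k : ℕ} (hk : 2 ≤ k) :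
    LinearMap.ker (pmIncidence k).mulVecLin
      = (LinearMap.ker (vertexTotal k)).map (endpointSum k) := by
  ext f
  rw [LinearMap.mem_ker, Matrix.mulVecLin_apply, Submodule.mem_map]
  constructor
  · intro hf
    let F : Fin (2 * k) → Fin (2 * k) → ℝ := fun u v =>
      if h : ¬ s(u, v).IsDiag then f ⟨s(u, v), h⟩ else 0
    have hF (u v) (h : ¬ s(u, v).IsDiag) : f ⟨s(u, v), h⟩ = F u v := by
      simp only [F, dif_pos h]
    have symm (u v) : F u v = F v u := by
      simp only [F, Sym2.eq_swap]
    obtain ⟨a, ha⟩ := exists_add_of_exchange symm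
      (fun _ _ _ _ h => exchange_of_mulVec_eq_zero hk hf hF h) (nodup_three hk)
    have hfa : endpointSum k a = f := by
      funext ⟨e, he⟩
      induction e with
      | h u v => rw [endpointSum_mk, hF, ha u v (by simpa using he)]
    refine ⟨a, ?_, hfa⟩
    let p : Fin k × Bool ≃ Fin (2 * k) := Fintype.equivOfCardEq (by simp [mul_comm])
    rw [LinearMap.mem_ker, vertexTotal_apply,
      ← pmIncidence_mulVec_endpointSum a (pairMatching p), hfa, hf]
    rfl
  · rintro ⟨a, ha, rfl⟩
    funext M
    rw [pmIncidence_mulVec_endpointSum, ← vertexTotal_apply, LinearMap.mem_ker.1 ha]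
    rfl

theorem finrank_ker_vertexTotal {k : ℕ} (hk : 2 ≤ k) :
    Module.finrank ℝ (LinearMap.ker (vertexTotal k)) + 1 = 2 * k := by
  have hne : vertexTotal k ≠ 0 := by
    intro h
    have h1 := vertexTotal_apply (k := k) fun _ => 1
    rw [h] at h1
    simp at h1
    omega
  have := Module.Dual.finrank_ker_add_one_of_ne_zero hne
  simpa using this

/-- the rank over `ℝ` of the perfect matching incidence matrix of
`K_{2k}` equals `2k² - 3k + 1`. -/
theorem stmt_11 (k : ℕ) (hk : 2 ≤ k) :
    (pmIncidence k).rank = 2 * k ^ 2 - 3 * k + 1 := by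
  have h := (pmIncidence k).mulVecLin.finrank_range_add_finrank_ker
  rw [ker_pmIncidence hk,
    ← (Submodule.equivMapOfInjective _ (endpointSum_injective hk) _).finrank_eq,
    Module.finrank_fintype_fun_eq_card, Sym2.card_subtype_not_diag, Fintype.card_fin,
    Nat.choose_two_right, mul_assoc, Nat.mul_div_cancel_left _ two_pos] at h
  have hd := finrank_ker_vertexTotal hk
  change Module.finrank ℝ (LinearMap.range (pmIncidence k).mulVecLin) = _
  obtain ⟨m, rfl⟩ := Nat.exists_eq_add_of_le hk
  have e1 : 2 * (2 + m) - 1 = 2 * m + 3 := by omega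
  have e2 : 2 * (2 + m) ^ 2 - 3 * (2 + m) = 2 * m ^ 2 + 5 * m + 2 := by
    rw [Nat.sub_eq_iff_eq_add (by nlinarith)]
    ring
  rw [e1] at h
  rw [e2]
  nlinarith
end

section
/- For every integer k ≥ 3, there exist distinct prime numbers p and q with k ≤ p < q < 2k. -/
/-- The real inequality, in logarithmic form, behind `two_mul_mul_bertrand_main_le`. -/
theorem two_mul_log_add_sqrt_mul_log_le {x : ℝ} (hx : 512 ≤ x) :
    Real.log x + Real.log x + √(2 * x) * Real.log (2 * x) + Real.log 2 ≤
      2 * Real.log 2 / 3 * x := by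
  let f : ℝ → ℝ := fun x =>
    Real.log x + Real.log x + √(2 * x) * Real.log (2 * x) - 2 * Real.log 2 / 3 * x
  have hlog2 : 0 < Real.log 2 := Real.log_pos (by norm_num)
  have hlog : ConcaveOn ℝ (Set.Ioi (0.5 : ℝ)) Real.log :=
    strictConcaveOn_log_Ioi.concaveOn.subset (Set.Ioi_subset_Ioi (by norm_num)) (convex_Ioi 0.5)
  have hf : ConcaveOn ℝ (Set.Ioi 0.5) f := by
    apply ConcaveOn.sub
    · apply (hlog.add hlog).add
      convert!
        ((strictConcaveOn_sqrt_mul_log_Ioi.concaveOn.comp_linearMap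
          ((2 : ℝ) • LinearMap.id)))
        using 1
      ext x
      simp only [Set.mem_Ioi, Set.mem_preimage, LinearMap.smul_apply,
        LinearMap.id_coe, id_eq, smul_eq_mul]
      rw [← mul_lt_mul_iff_right₀ (two_pos)]
      norm_num1
      rfl
    · exact (convexOn_id (convex_Ioi (0.5 : ℝ))).smul (by positivity)
  have h18 : 0 ≤ f 18 := by
    have hs : √(2 * 18 : ℝ) = 6 :=
      (Real.sqrt_eq_iff_mul_self_eq_of_pos (by norm_num1)).mpr (by norm_num1)
    have h1 : 0 ≤ Real.log 18 := Real.log_nonneg (by norm_num)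
    have h2 : 2 * Real.log 2 ≤ Real.log (2 * 18) := by
      rw [← Real.log_rpow two_pos]
      exact Real.log_le_log (by positivity) (by norm_num)
    simp only [f, hs]
    generalize Real.log (2 * 18) = a at *
    linarith
  have h512 : f 512 ≤ -Real.log 2 := by
    have hs : √(2 * 512 : ℝ) = 32 :=
      (Real.sqrt_eq_iff_mul_self_eq_of_pos (by norm_num1)).mpr (by norm_num1)
    have h1 : Real.log 512 = 9 * Real.log 2 := by
      rw [show (512 : ℝ) = 2 ^ 9 by norm_num, Real.log_pow]; norm_num
    have h2 : Real.log (2 * 512) = 10 * Real.log 2 := by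
      rw [show (2 * 512 : ℝ) = 2 ^ 10 by norm_num, Real.log_pow]; norm_num
    simp only [f, hs, h1, h2]
    linarith
  have hfx : f x ≤ f 512 :=
    hf.right_le_of_le_left'' (x := 18) (by norm_num) (Set.mem_Ioi.mpr (by linarith))
      (by norm_num) hx (by linarith)
  have := hfx.trans h512
  simp only [f] at this
  linarith

/-- A strengthening of `bertrand_main_inequality` by a factor `2 * n`. -/
theorem two_mul_mul_bertrand_main_le {n : ℕ} (hn : 512 ≤ n) :
    n * (2 * n * ((2 * n) ^ Nat.sqrt (2 * n) * 4 ^ (2 * n / 3))) ≤ 4 ^ n := by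
  have hn' : (512 : ℝ) ≤ n := by exact_mod_cast hn
  have hpos : (0 : ℝ) < n := by linarith
  have key := two_mul_log_add_sqrt_mul_log_le hn'
  have hlog2 : 0 < Real.log 2 := Real.log_pos (by norm_num)
  have hlog4 : Real.log 4 = 2 * Real.log 2 := by
    rw [show (4 : ℝ) = 2 ^ 2 by norm_num, Real.log_pow]; norm_num
  have hsqrt : (Nat.sqrt (2 * n) : ℝ) * Real.log (2 * n) ≤ √(2 * n) * Real.log (2 * n) := by
    refine mul_le_mul_of_nonneg_right ?_ (Real.log_nonneg (by linarith))
    exact_mod_cast Real.nat_sqrt_le_real_sqrt (a := 2 * n)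
  have hdiv : ((2 * n / 3 : ℕ) : ℝ) * (2 * Real.log 2) ≤ 2 * n / 3 * (2 * Real.log 2) := by
    refine mul_le_mul_of_nonneg_right ?_ (by positivity)
    exact Nat.cast_div_le.trans (by norm_cast)
  rw [← Nat.cast_le (α := ℝ)]
  push_cast
  have h2n : Real.log (2 * n) = Real.log 2 + Real.log n :=
    Real.log_mul (by norm_num) hpos.ne'
  rw [← Real.log_le_log_iff (by positivity) (by positivity), Real.log_mul hpos.ne' (by positivity),
    Real.log_mul (x := 2 * (n : ℝ)) (by positivity) (by positivity),
    Real.log_mul (y := 4 ^ (2 * n / 3)) (by positivity) (by positivity),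
    Real.log_pow, Real.log_pow, Real.log_pow, hlog4]
  linarith

/-- The part of the prime factorization of the central binomial coefficient supported on primes
at most `2 * n / 3`. -/
theorem prod_pow_factorization_centralBinom_small_le {n : ℕ} (hn : 0 < n) :
    ∏ p ∈ Finset.range (2 * n / 3 + 1), p ^ (n.centralBinom).factorization p ≤
      (2 * n) ^ Nat.sqrt (2 * n) * 4 ^ (2 * n / 3) := by
  have n2_pos : 1 ≤ 2 * n := by lia
  let S := {p ∈ Finset.range (2 * n / 3 + 1) | Nat.Prime p}
  let f x := x ^ n.centralBinom.factorization x
  have : ∏ x ∈ S, f x = ∏ x ∈ Finset.range (2 * n / 3 + 1), f x := by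
    refine Finset.prod_filter_of_ne fun p _ h => ?_
    contrapose h
    dsimp only [f]
    rw [Nat.factorization_eq_zero_of_not_prime n.centralBinom h, pow_zero]
  rw [← this, ← Finset.prod_filter_mul_prod_filter_not S (· ≤ Nat.sqrt (2 * n))]
  apply mul_le_mul'
  · refine (Finset.prod_le_prod' fun p _ => (?_ : f p ≤ 2 * n)).trans ?_
    · exact Nat.pow_factorization_choose_le n2_pos
    have : (Finset.Icc 1 (Nat.sqrt (2 * n))).card = Nat.sqrt (2 * n) := by
      rw [Nat.card_Icc, Nat.add_sub_cancel]
    rw [Finset.prod_const]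
    refine pow_right_mono₀ n2_pos ((Finset.card_le_card fun x hx => ?_).trans this.le)
    obtain ⟨h1, h2⟩ := Finset.mem_filter.1 hx
    exact Finset.mem_Icc.mpr ⟨(Finset.mem_filter.1 h1).2.one_lt.le, h2⟩
  · refine le_trans ?_ (primorial_le_four_pow (2 * n / 3))
    refine (Finset.prod_le_prod' fun p hp => (?_ : f p ≤ p)).trans ?_
    · obtain ⟨h1, h2⟩ := Finset.mem_filter.1 hp
      refine (pow_right_mono₀ (Finset.mem_filter.1 h1).2.one_lt.le ?_).trans (pow_one p).le
      exact Nat.factorization_choose_le_one (Nat.sqrt_lt'.mp <| not_le.1 h2)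
    refine Finset.prod_le_prod_of_subset_of_one_le' (Finset.filter_subset _ _) ?_
    exact fun p hp _ => (Finset.mem_filter.1 hp).2.one_lt.le

/-- If `q` is the only prime in `(n, 2 * n]`, the central binomial coefficient is small. -/
theorem centralBinom_le_of_unique_bertrand_prime {n q : ℕ} (hn : 2 < n) (hnq : n < q)
    (hq : q ≤ 2 * n) (unique : ∀ p : ℕ, p.Prime → n < p → p ≤ 2 * n → p = q) :
    n.centralBinom ≤ 2 * n * ((2 * n) ^ Nat.sqrt (2 * n) * 4 ^ (2 * n / 3)) := by
  have hq_notMem : q ∉ Finset.range (2 * n / 3 + 1) := by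
    rw [Finset.mem_range]
    lia
  have hprod : ∏ p ∈ insert q (Finset.range (2 * n / 3 + 1)),
      p ^ (n.centralBinom).factorization p = n.centralBinom := by
    refine Eq.trans ?_ n.prod_pow_factorization_centralBinom
    apply Finset.prod_subset
    · intro x hx
      simp only [Finset.mem_insert, Finset.mem_range] at hx ⊢
      lia
    intro x hx h2x
    simp only [Finset.mem_insert, Finset.mem_range, not_or] at hx h2x
    by_cases hxp : x.Prime
    · have hxn : x ≤ n := by
        by_contra! h
        exact h2x.1 (unique x hxp h (by lia))
      rw [Nat.factorization_centralBinom_of_two_mul_self_lt_three_mul hn hxn (by lia), pow_zero]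
    · rw [Nat.factorization_eq_zero_of_not_prime n.centralBinom hxp, pow_zero]
  rw [← hprod, Finset.prod_insert hq_notMem]
  exact mul_le_mul' (Nat.pow_factorization_choose_le (by lia))
    (prod_pow_factorization_centralBinom_small_le (by lia))

theorem exists_two_primes_lt_and_le_two_mul {n : ℕ} (hn : 512 ≤ n) :
    ∃ p q : ℕ, p.Prime ∧ q.Prime ∧ n < p ∧ p < q ∧ q ≤ 2 * n := by
  obtain ⟨q, hq, hnq, hq2⟩ := Nat.exists_prime_lt_and_le_two_mul n (by lia)
  by_contra! hno
  have unique : ∀ p : ℕ, p.Prime → n < p → p ≤ 2 * n → p = q := by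
    intro p hp hnp hp2
    rcases lt_trichotomy p q with h | h | h
    · exact absurd hq2 (hno p q hp hq hnp h).not_ge
    · exact h
    · exact absurd hp2 (hno q p hq hp hnq h).not_ge
  have hlt := Nat.four_pow_lt_mul_centralBinom n (by lia)
  have hle := Nat.mul_le_mul_left n
    (centralBinom_le_of_unique_bertrand_prime (by lia) hnq hq2 unique)
  exact absurd (hlt.trans_le (hle.trans (two_mul_mul_bertrand_main_le hn))) (lt_irrefl _)

/-- for every integer `k ≥ 3` there are distinct primes `p` and
`q` with `k ≤ p < q < 2k`. -/
theorem stmt_17 (k : ℕ) (hk : 3 ≤ k) :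
    ∃ p q : ℕ, p.Prime ∧ q.Prime ∧ k ≤ p ∧ p < q ∧ q < 2 * k := by
  rcases le_or_gt 512 k with h | h
  · obtain ⟨p, q, hp, hq, hkp, hpq, hqk⟩ := exists_two_primes_lt_and_le_two_mul h
    refine ⟨p, q, hp, hq, hkp.le, hpq, hqk.lt_of_ne ?_⟩
    rintro rfl
    exact Nat.not_prime_mul (by norm_num) (by lia) hq
  · have of_pair (p q : ℕ) (hp : p.Prime) (hq : q.Prime) (hpq : p < q) (hkp : k ≤ p)
        (hqk : q < 2 * k) :
        ∃ p q : ℕ, p.Prime ∧ q.Prime ∧ k ≤ p ∧ p < q ∧ q < 2 * k :=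
      ⟨p, q, hp, hq, hkp, hpq, hqk⟩
    have h3 := of_pair 3 5 (by norm_num) (by norm_num) (by norm_num)
    have h5 := of_pair 5 7 (by norm_num) (by norm_num) (by norm_num)
    have h7 := of_pair 7 11 (by norm_num) (by norm_num) (by norm_num)
    have h11 := of_pair 11 13 (by norm_num) (by norm_num) (by norm_num)
    have h19 := of_pair 19 23 (by norm_num) (by norm_num) (by norm_num)
    have h31 := of_pair 31 37 (by norm_num) (by norm_num) (by norm_num)
    have h59 := of_pair 59 61 (by norm_num) (by norm_num) (by norm_num)
    have h109 := of_pair 109 113 (by norm_num) (by norm_num) (by norm_num)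
    have h197 := of_pair 197 199 (by norm_num) (by norm_num) (by norm_num)
    have h379 := of_pair 379 383 (by norm_num) (by norm_num) (by norm_num)
    have h601 := of_pair 601 607 (by norm_num) (by norm_num) (by norm_num)
    by_contra hno
    simp only [hno, imp_false, not_lt] at h3 h5 h7 h11 h19 h31 h59 h109 h197 h379 h601
    lia
end
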